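/- arXiv:2111.03650 — 3 statements merged into one kernel-verified Lean document; each statement's English description precedes it below -/
import Mathlib

section
/- For all real ν ≥ 0 and all real z ≥ 0, ((z/2)^ν·e^{−z})/Γ(ν+1) ≤ I_ν(z) ≤ ((z/2)^ν·e^{z})/Γ(ν+1). -/
/-- The modified Bessel function of the first kind, via the integral representation
`I_α(z) = ((z/2)^α / (√π·Γ(α+1/2))) ∫₀^π e^{z cos η} (sin η)^{2α} dη`. -/
noncomputable def besselI (α z : ℝ) : ℝ :=
  (z / 2) ^ α / (Real.sqrt Real.pi * Real.Gamma (α + 1 / 2)) *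
    ∫ η in (0:ℝ)..Real.pi, Real.exp (z * Real.cos η) * Real.sin η ^ (2 * α)

theorem integral_rpow_mul_one_sub_rpow {a b : ℝ} (ha : 0 < a) (hb : 0 < b) :
    ∫ x in (0:ℝ)..1, x ^ (a - 1) * (1 - x) ^ (b - 1) =
      Real.Gamma a * Real.Gamma b / Real.Gamma (a + b) := by
  change _ = ProbabilityTheory.beta a b
  rw [ProbabilityTheory.beta_eq_betaIntegralReal a b ha hb, Complex.betaIntegral,
    ← Complex.ofReal_re (∫ x in (0:ℝ)..1, x ^ (a - 1) * (1 - x) ^ (b - 1)),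
    ← intervalIntegral.integral_ofReal]
  congr 1
  refine intervalIntegral.integral_congr fun x hx => ?_
  rw [Set.uIcc_of_le zero_le_one] at hx
  push_cast [Complex.ofReal_cpow hx.1, Complex.ofReal_cpow (sub_nonneg.2 hx.2)]
  rfl

theorem integral_sin_rpow_two_mul {ν : ℝ} (hν : 0 ≤ ν) :
    ∫ η in (0:ℝ)..Real.pi, Real.sin η ^ (2 * ν) =
      Real.sqrt Real.pi * Real.Gamma (ν + 1 / 2) / Real.Gamma (ν + 1) := by
  have hsubst := intervalIntegral.integral_comp_mul_deriv_of_deriv_nonneg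
    (a := 0) (b := Real.pi) (f := fun η => (1 - Real.cos η) / 2)
    (f' := fun η => Real.sin η / 2)
    (g := fun x => x ^ (ν + 1 / 2 - 1) * (1 - x) ^ (ν + 1 / 2 - 1))
    (by fun_prop)
    (fun x _ => by simpa using ((Real.hasDerivAt_cos x).const_sub 1).div_const 2)
    (fun x hx => by
      rw [min_eq_left Real.pi_pos.le, max_eq_right Real.pi_pos.le] at hx
      exact div_nonneg (Real.sin_pos_of_mem_Ioo hx).le zero_le_two)
  have hbeta := integral_rpow_mul_one_sub_rpow (a := ν + 1 / 2) (b := ν + 1 / 2)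
    (by positivity) (by positivity)
  have hdup := Real.Gamma_mul_Gamma_add_half (ν + 1 / 2)
  have hcongr : ∫ η in (0:ℝ)..Real.pi,
      ((fun x : ℝ => x ^ (ν + 1 / 2 - 1) * (1 - x) ^ (ν + 1 / 2 - 1)) ∘
        fun η => (1 - Real.cos η) / 2) η * (Real.sin η / 2) =
      ∫ η in (0:ℝ)..Real.pi, (2:ℝ) ^ (-(2 * ν)) * Real.sin η ^ (2 * ν) := by
    refine intervalIntegral.integral_congr_Ioo_of_le Real.pi_pos.le fun η hη => ?_
    have hs := Real.sin_pos_of_mem_Ioo hη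
    have hcos := Real.cos_le_one η
    have hcos' := Real.neg_one_le_cos η
    have hprod : (1 - Real.cos η) / 2 * (1 - (1 - Real.cos η) / 2) = (Real.sin η / 2) ^ (2:ℝ) := by
      rw [Real.rpow_two]
      linear_combination (-1 / 4) * Real.sin_sq_add_cos_sq η
    simp only [Function.comp_apply]
    rw [← Real.mul_rpow (by linarith) (by linarith), hprod, ← Real.rpow_mul (by positivity)]
    nth_rewrite 2 [← Real.rpow_one (Real.sin η / 2)]
    rw [← Real.rpow_add (by positivity), Real.div_rpow hs.le zero_le_two,
      Real.rpow_neg zero_le_two]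
    ring_nf
  rw [hcongr, intervalIntegral.integral_const_mul] at hsubst
  rw [Real.cos_zero, Real.cos_pi, sub_self, zero_div, sub_neg_eq_add, one_add_one_eq_two,
    div_self two_ne_zero, hbeta] at hsubst
  have hΓ : 0 < Real.Gamma (ν + 1) := Real.Gamma_pos_of_pos (by positivity)
  have hΓ' : 0 < Real.Gamma (2 * (ν + 1 / 2)) := Real.Gamma_pos_of_pos (by positivity)
  have htwo : (0:ℝ) < 2 ^ (-(2 * ν)) := by positivity
  rw [show ν + 1 / 2 + 1 / 2 = ν + 1 by ring,
    show 1 - 2 * (ν + 1 / 2) = -(2 * ν) by ring] at hdup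
  rw [← two_mul (ν + 1 / 2), eq_div_iff hΓ'.ne'] at hsubst
  rw [eq_div_iff hΓ.ne']
  refine mul_left_cancel₀ (mul_pos htwo hΓ').ne' ?_
  linear_combination Real.Gamma (ν + 1) * hsubst + Real.Gamma (ν + 1 / 2) * hdup

/-- For all `ν ≥ 0` and `z ≥ 0`,
`((z/2)^ν e^{-z})/Γ(ν+1) ≤ I_ν(z) ≤ ((z/2)^ν e^{z})/Γ(ν+1)`. -/
theorem besselI_bounds (ν z : ℝ) (hν : 0 ≤ ν) (hz : 0 ≤ z) :
    (z / 2) ^ ν * Real.exp (-z) / Real.Gamma (ν + 1) ≤ besselI ν z ∧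
      besselI ν z ≤ (z / 2) ^ ν * Real.exp z / Real.Gamma (ν + 1) := by
  have hΓ : 0 < Real.Gamma (ν + 1 / 2) := Real.Gamma_pos_of_pos (by positivity)
  have hpre : 0 ≤ (z / 2) ^ ν / (Real.sqrt Real.pi * Real.Gamma (ν + 1 / 2)) := by positivity
  have hpow : Continuous fun η : ℝ => Real.sin η ^ (2 * ν) :=
    Real.continuous_sin.rpow_const fun _ => Or.inr (by positivity)
  have hint : Continuous fun η : ℝ => Real.exp (z * Real.cos η) * Real.sin η ^ (2 * ν) := by
    fun_prop
  have hscale (c : ℝ) : (z / 2) ^ ν * c / Real.Gamma (ν + 1) =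
      (z / 2) ^ ν / (Real.sqrt Real.pi * Real.Gamma (ν + 1 / 2)) *
        ∫ η in (0:ℝ)..Real.pi, c * Real.sin η ^ (2 * ν) := by
    rw [intervalIntegral.integral_const_mul, integral_sin_rpow_two_mul hν]
    have := Real.sqrt_pos.2 Real.pi_pos
    field_simp
  rw [hscale, hscale, besselI]
  constructor <;> refine mul_le_mul_of_nonneg_left ?_ hpre <;>
    refine intervalIntegral.integral_mono_on Real.pi_pos.le
      (Continuous.intervalIntegrable (by fun_prop) _ _)
      (Continuous.intervalIntegrable (by fun_prop) _ _) fun η hη => ?_ <;>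
    refine mul_le_mul_of_nonneg_right (Real.exp_le_exp.2 ?_)
      (Real.rpow_nonneg (Real.sin_nonneg_of_mem_Icc hη) _)
  · nlinarith [Real.neg_one_le_cos η]
  · nlinarith [Real.cos_le_one η]
end

section
/- For every real α > 1 there exists a constant C < ∞ (depending only on α) such that for all q ≥ 0 the series Σ_{j=1}^∞ j²·I_{αj}(q) converges and satisfies both Σ_{j=1}^∞ j²·I_{αj}(q) ≤ C·e^{q}·(e^{(q/2)^α} − 1) and Σ_{j=1}^∞ j²·I_{αj}(q) ≤ C·q^{α}·e^{C·q}. -/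
/-- Proved by bounding the Gamma integral below by its part over `(y, ∞)`. -/
theorem rpow_le_Gamma_mul_exp {s y : ℝ} (hs : 0 ≤ s) (hy : 0 ≤ y) :
    y ^ s ≤ Real.Gamma (s + 1) * Real.exp y := by
  have hint := Real.GammaIntegral_convergent (s := s + 1) (by linarith)
  have hle : ∫ x in Set.Ioi y, Real.exp (-x) * y ^ s ≤ Real.Gamma (s + 1) := by
    rw [Real.Gamma_eq_integral (by linarith)]
    have hsub : Set.Ioi y ⊆ Set.Ioi (0 : ℝ) := Set.Ioi_subset_Ioi hy
    calc ∫ x in Set.Ioi y, Real.exp (-x) * y ^ s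
        ≤ ∫ x in Set.Ioi y, Real.exp (-x) * x ^ (s + 1 - 1) := by
          refine MeasureTheory.setIntegral_mono_on ?_ (hint.mono_set hsub) measurableSet_Ioi ?_
          · exact (integrableOn_exp_neg_Ioi y).mul_const _
          · intro x hx
            have hyx : y ≤ x := le_of_lt hx
            rw [add_sub_cancel_right]
            gcongr
      _ ≤ ∫ x in Set.Ioi 0, Real.exp (-x) * x ^ (s + 1 - 1) := by
          refine MeasureTheory.setIntegral_mono_set hint ?_ hsub.eventuallyLE
          filter_upwards [MeasureTheory.ae_restrict_mem measurableSet_Ioi] with x hx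
          have hx0 : (0 : ℝ) < x := hx
          simp only [Pi.zero_apply]
          positivity
  rw [MeasureTheory.integral_mul_const, integral_exp_neg_Ioi] at hle
  calc y ^ s = Real.exp (-y) * y ^ s * Real.exp y := by
        rw [mul_right_comm, ← Real.exp_add]; simp
    _ ≤ _ := by gcongr

theorem besselI_nonneg {β q : ℝ} (hβ : 0 ≤ β) (hq : 0 ≤ q) : 0 ≤ besselI β q := by
  have hΓ : 0 < Real.Gamma (β + 1 / 2) := Real.Gamma_pos_of_pos (by linarith)
  refine mul_nonneg (by positivity) (intervalIntegral.integral_nonneg Real.pi_pos.le ?_)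
  intro η hη
  have := Real.sin_nonneg_of_mem_Icc hη
  positivity

theorem besselI_le {β q : ℝ} (hβ : 0 ≤ β) (hq : 0 ≤ q) :
    besselI β q ≤ √Real.pi * ((q / 2) ^ β / Real.Gamma (β + 1 / 2)) * Real.exp q := by
  have hΓ : 0 < Real.Gamma (β + 1 / 2) := Real.Gamma_pos_of_pos (by linarith)
  have hI : ∫ η in (0 : ℝ)..Real.pi, Real.exp (q * Real.cos η) * Real.sin η ^ (2 * β)
      ≤ Real.exp q * Real.pi := by
    refine (Real.le_norm_self _).trans ?_
    have h := intervalIntegral.norm_integral_le_of_norm_le_const (a := 0) (b := Real.pi)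
      (f := fun η => Real.exp (q * Real.cos η) * Real.sin η ^ (2 * β)) (C := Real.exp q) ?_
    · simpa [abs_of_pos Real.pi_pos] using h
    · intro η hη
      rw [Set.uIoc_of_le Real.pi_pos.le] at hη
      have hs := Real.sin_nonneg_of_mem_Icc ⟨hη.1.le, hη.2⟩
      rw [Real.norm_of_nonneg (by positivity)]
      have h1 : Real.exp (q * Real.cos η) ≤ Real.exp q :=
        Real.exp_le_exp.2 (mul_le_of_le_one_right hq (Real.cos_le_one η))
      have h2 : Real.sin η ^ (2 * β) ≤ 1 :=
        Real.rpow_le_one hs (Real.sin_le_one η) (by linarith)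
      exact (mul_le_mul h1 h2 (by positivity) (by positivity)).trans_eq (mul_one _)
  calc besselI β q ≤ (q / 2) ^ β / (√Real.pi * Real.Gamma (β + 1 / 2)) *
        (Real.exp q * Real.pi) := by
        unfold besselI
        gcongr
    _ = _ := by
        rw [show (q / 2) ^ β / (√Real.pi * Real.Gamma (β + 1 / 2)) * (Real.exp q * Real.pi) =
          Real.pi / √Real.pi * ((q / 2) ^ β / Real.Gamma (β + 1 / 2)) * Real.exp q by
            field_simp, Real.div_sqrt]

theorem Gamma_le_mul_Gamma {u v : ℝ} (hu : 1 ≤ u) (huv : u ≤ v) :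
    Real.Gamma u ≤ v * Real.Gamma v := by
  have hΓ : 0 < Real.Gamma u := Real.Gamma_pos_of_pos (by linarith)
  calc Real.Gamma u ≤ u * Real.Gamma u := le_mul_of_one_le_left hΓ.le hu
    _ = Real.Gamma (u + 1) := (Real.Gamma_add_one (by linarith)).symm
    _ ≤ Real.Gamma (v + 1) := Real.Gamma_strictMonoOn_Ici.monotoneOn
        (Set.mem_Ici.2 (by linarith)) (Set.mem_Ici.2 (by linarith)) (by linarith)
    _ = v * Real.Gamma v := Real.Gamma_add_one (by linarith)

theorem exists_sq_mul_factorial_le_Gamma {α : ℝ} (hα : 1 < α) :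
    ∃ C : ℝ, ∀ m : ℕ,
      (m : ℝ) ^ 2 * (m.factorial : ℝ) ≤ C * Real.Gamma (α * m + 1 / 2) := by
  have hΓ (m : ℕ) : 0 < Real.Gamma (α * m + 1 / 2) := Real.Gamma_pos_of_pos (by positivity)
  obtain ⟨N, hN⟩ := exists_nat_ge (5 / 2 / (α - 1))
  set r : ℕ → ℝ := fun m => (m : ℝ) ^ 2 * (m.factorial : ℝ) / Real.Gamma (α * m + 1 / 2)
  have hr (m : ℕ) : 0 ≤ r m := div_nonneg (by positivity) (hΓ m).le
  have hsum : 0 ≤ ∑ i ∈ Finset.range N, r i := Finset.sum_nonneg fun i _ => hr i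
  refine ⟨1 + ∑ i ∈ Finset.range N, r i, fun m => ?_⟩
  rw [← div_le_iff₀ (hΓ m)]
  change r m ≤ _
  rcases lt_or_ge m N with hm | hm
  · have := Finset.single_le_sum (fun i _ => hr i) (Finset.mem_range.2 hm)
    linarith
  · have hm' : (N : ℝ) ≤ m := by exact_mod_cast hm
    have hgap : 5 / 2 ≤ (m : ℝ) * (α - 1) := by
      rw [← div_le_iff₀ (by linarith)]
      exact hN.trans hm'
    have hmono : Real.Gamma (((m + 2 : ℕ) : ℝ) + 1) ≤ Real.Gamma (α * m + 1 / 2) := by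
      have hm0 : (0 : ℝ) ≤ m := m.cast_nonneg
      refine Real.Gamma_strictMonoOn_Ici.monotoneOn (Set.mem_Ici.2 ?_) (Set.mem_Ici.2 ?_) ?_ <;>
        push_cast <;> nlinarith
    rw [Real.Gamma_nat_eq_factorial, Nat.factorial_succ, Nat.factorial_succ] at hmono
    push_cast at hmono
    have hle : (m : ℝ) ^ 2 * (m.factorial : ℝ) ≤
        ((m : ℝ) + 1 + 1) * (((m : ℝ) + 1) * (m.factorial : ℝ)) := by
      rw [← mul_assoc]
      gcongr
      nlinarith [m.cast_nonneg (α := ℝ)]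
    have : r m ≤ 1 := (div_le_one (hΓ m)).2 (hle.trans hmono)
    linarith

theorem summable_succ_pow_three_mul_half_pow :
    Summable fun n : ℕ => ((n : ℝ) + 1) ^ 3 * (1 / 2 : ℝ) ^ n := by
  have h := (summable_nat_add_iff 1).2 (summable_pow_mul_geometric_of_norm_lt_one (R := ℝ) 3
    (r := 1 / 2) (by norm_num))
  refine (h.mul_left 2).congr fun n => ?_
  push_cast
  ring

theorem hasSum_pow_succ_div_factorial (x : ℝ) :
    HasSum (fun n : ℕ => x ^ (n + 1) / ((n + 1).factorial : ℝ)) (Real.exp x - 1) := by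
  have h := NormedSpace.expSeries_div_hasSum_exp (𝔸 := ℝ) x
  rw [← Real.exp_eq_exp_ℝ] at h
  simpa using (hasSum_nat_add_iff' 1).2 h

theorem sq_mul_besselI_le_pow_div_factorial {α A q : ℝ} (hα : 1 < α) (hq : 0 ≤ q)
    (hA : ∀ m : ℕ, (m : ℝ) ^ 2 * (m.factorial : ℝ) ≤ A * Real.Gamma (α * m + 1 / 2)) (m : ℕ) :
    (m : ℝ) ^ 2 * besselI (α * m) q ≤
      √Real.pi * A * Real.exp q * (((q / 2) ^ α) ^ m / (m.factorial : ℝ)) := by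
  have hΓ : 0 < Real.Gamma (α * m + 1 / 2) := Real.Gamma_pos_of_pos (by positivity)
  have hf : (0 : ℝ) < m.factorial := by exact_mod_cast m.factorial_pos
  have hquot : (m : ℝ) ^ 2 / Real.Gamma (α * m + 1 / 2) ≤ A / m.factorial :=
    (div_le_div_iff₀ hΓ hf).2 (hA m)
  calc (m : ℝ) ^ 2 * besselI (α * m) q
      ≤ (m : ℝ) ^ 2 *
        (√Real.pi * ((q / 2) ^ (α * m) / Real.Gamma (α * m + 1 / 2)) * Real.exp q) := by
        gcongr
        exact besselI_le (by positivity) hq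
    _ = √Real.pi * Real.exp q * ((q / 2) ^ α) ^ m *
        ((m : ℝ) ^ 2 / Real.Gamma (α * m + 1 / 2)) := by
        rw [Real.rpow_mul (by positivity), Real.rpow_natCast]
        ring
    _ ≤ √Real.pi * Real.exp q * ((q / 2) ^ α) ^ m * (A / m.factorial) := by gcongr
    _ = _ := by ring

theorem sq_mul_besselI_le_geometric {α q : ℝ} (hα : 1 < α) (hq : 0 ≤ q) (n : ℕ) :
    ((n : ℝ) + 1) ^ 2 * besselI (α * ((n : ℝ) + 1)) q ≤
      √Real.pi * (2 * α) * q ^ α * Real.exp (2 * q) * (((n : ℝ) + 1) ^ 3 * (1 / 2 : ℝ) ^ n) := by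
  have hΓ : 0 < Real.Gamma (α * ((n : ℝ) + 1) + 1 / 2) := Real.Gamma_pos_of_pos (by positivity)
  have hn : (0 : ℝ) ≤ n := n.cast_nonneg
  have hαn : (0 : ℝ) ≤ α * n := by positivity
  have hhalf : (1 / 2 : ℝ) ^ (α * n) ≤ (1 / 2 : ℝ) ^ n := by
    rw [← Real.rpow_natCast]
    exact Real.rpow_le_rpow_of_exponent_ge (by norm_num) (by norm_num) (by nlinarith)
  have hGamma : Real.Gamma (α * n + 1) ≤
      2 * α * ((n : ℝ) + 1) * Real.Gamma (α * ((n : ℝ) + 1) + 1 / 2) := by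
    refine (Gamma_le_mul_Gamma (v := α * ((n : ℝ) + 1) + 1 / 2) (by linarith)
      (by linarith)).trans ?_
    gcongr
    nlinarith
  have hpow : (q / 2) ^ (α * ((n : ℝ) + 1)) ≤ q ^ α * ((1 / 2 : ℝ) ^ n *
      (2 * α * ((n : ℝ) + 1) * Real.Gamma (α * ((n : ℝ) + 1) + 1 / 2) * Real.exp q)) := by
    rw [mul_add_one, add_comm, Real.rpow_add_of_nonneg (by positivity) (by positivity) hαn]
    rw [show α + α * (n : ℝ) = α * ((n : ℝ) + 1) by ring]
    gcongr ?_ * ?_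
    · gcongr
      linarith
    · rw [div_eq_mul_one_div, mul_comm q, Real.mul_rpow (by norm_num) hq]
      gcongr
      exact (rpow_le_Gamma_mul_exp hαn hq).trans (by gcongr)
  have hquot : (q / 2) ^ (α * ((n : ℝ) + 1)) / Real.Gamma (α * ((n : ℝ) + 1) + 1 / 2) ≤
      q ^ α * ((1 / 2 : ℝ) ^ n * (2 * α * ((n : ℝ) + 1) * Real.exp q)) :=
    (div_le_iff₀ hΓ).2 (hpow.trans_eq (by ring))
  calc ((n : ℝ) + 1) ^ 2 * besselI (α * ((n : ℝ) + 1)) q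
      ≤ ((n : ℝ) + 1) ^ 2 * (√Real.pi * ((q / 2) ^ (α * ((n : ℝ) + 1)) /
        Real.Gamma (α * ((n : ℝ) + 1) + 1 / 2)) * Real.exp q) := by
        gcongr
        exact besselI_le (by positivity) hq
    _ ≤ ((n : ℝ) + 1) ^ 2 * (√Real.pi *
        (q ^ α * ((1 / 2 : ℝ) ^ n * (2 * α * ((n : ℝ) + 1) * Real.exp q))) * Real.exp q) :=
        mul_le_mul_of_nonneg_left (mul_le_mul_of_nonneg_right
          (mul_le_mul_of_nonneg_left hquot (Real.sqrt_nonneg _)) (Real.exp_pos q).le)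
          (by positivity)
    _ = _ := by
        rw [two_mul q, Real.exp_add]
        ring

/-- For `α > 1` there is a constant `C` such that for all `q ≥ 0`, the series
`Σ_{j≥1} j² I_{αj}(q)` converges and is at most `C e^q (e^{(q/2)^α} - 1)` and
at most `C q^α e^{Cq}`. -/
theorem besselI_sum_bound (α : ℝ) (hα : 1 < α) :
    ∃ C : ℝ, 0 < C ∧ ∀ q : ℝ, 0 ≤ q →
      Summable (fun j : ℕ => ((j : ℝ) + 1) ^ 2 * besselI (α * ((j : ℝ) + 1)) q) ∧
      (∑' j : ℕ, ((j : ℝ) + 1) ^ 2 * besselI (α * ((j : ℝ) + 1)) q) ≤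
        C * Real.exp q * (Real.exp ((q / 2) ^ α) - 1) ∧
      (∑' j : ℕ, ((j : ℝ) + 1) ^ 2 * besselI (α * ((j : ℝ) + 1)) q) ≤
        C * q ^ α * Real.exp (C * q) := by
  obtain ⟨A, hA⟩ := exists_sq_mul_factorial_le_Gamma hα
  set S : ℝ := ∑' n : ℕ, ((n : ℝ) + 1) ^ 3 * (1 / 2 : ℝ) ^ n
  set C : ℝ := max 2 (max (√Real.pi * A) (√Real.pi * (2 * α) * S))
  have hC2 : 2 ≤ C := le_max_left _ _
  have hCA : √Real.pi * A ≤ C := (le_max_left _ _).trans (le_max_right _ _)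
  have hCS : √Real.pi * (2 * α) * S ≤ C := (le_max_right _ _).trans (le_max_right _ _)
  refine ⟨C, by linarith, fun q hq => ?_⟩
  have hexp := (hasSum_pow_succ_div_factorial ((q / 2) ^ α)).mul_left (√Real.pi * A * Real.exp q)
  have hexp_le (n : ℕ) : ((n : ℝ) + 1) ^ 2 * besselI (α * ((n : ℝ) + 1)) q ≤
      √Real.pi * A * Real.exp q * (((q / 2) ^ α) ^ (n + 1) / ((n + 1).factorial : ℝ)) := by
    simpa using sq_mul_besselI_le_pow_div_factorial hα hq hA (n + 1)
  have hgeom := summable_succ_pow_three_mul_half_pow.hasSum.mul_left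
    (√Real.pi * (2 * α) * q ^ α * Real.exp (2 * q))
  have hsummable : Summable fun j : ℕ => ((j : ℝ) + 1) ^ 2 * besselI (α * ((j : ℝ) + 1)) q :=
    Summable.of_nonneg_of_le
      (fun n => mul_nonneg (by positivity) (besselI_nonneg (by positivity) hq)) hexp_le
      hexp.summable
  refine ⟨hsummable, ?_, ?_⟩
  · refine (hasSum_le hexp_le hsummable.hasSum hexp).trans ?_
    have : 0 ≤ Real.exp ((q / 2) ^ α) - 1 := sub_nonneg.2 (Real.one_le_exp (by positivity))
    gcongr
  · refine (hasSum_le (sq_mul_besselI_le_geometric hα hq) hsummable.hasSum hgeom).trans ?_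
    calc √Real.pi * (2 * α) * q ^ α * Real.exp (2 * q) * S
        = √Real.pi * (2 * α) * S * q ^ α * Real.exp (2 * q) := by ring
      _ ≤ C * q ^ α * Real.exp (C * q) := by gcongr
end

section
/- There exists a constant C > 0 such that for all x > 0, all r₁, r₂ > 0, and all θ₁, θ₂ ∈ [−π/3, π/3], the series defining p_x^N(r₁·e^{iθ₁}, r₂·e^{iθ₂}) converges absolutely and p_x^N(r₁·e^{iθ₁}, r₂·e^{iθ₂}) ≤ C·(r₁·r₂)^{3/2}·x^{−5/2}·e^{(C·r₁·r₂ − r₁² − r₂²)/(2x)}·(π/3 − |θ₁|)·(π/3 − |θ₂|). -/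
/-- The `j`-th term (`j = 0, 1, 2, …` corresponding to indices `1, 2, 3, …`) of the
series defining the heat kernel `p_x^N(r₁e^{iθ₁}, r₂e^{iθ₂})` of planar Brownian
motion killed on the boundary of the wedge `N` of opening angle `2π/3`. -/
noncomputable def wedgeTerm (x r₁ θ₁ r₂ θ₂ : ℝ) (j : ℕ) : ℝ :=
  besselI (3 / 2 * ((j : ℝ) + 1)) (r₁ * r₂ / x) *
    (Real.exp (-r₁ ^ 2 / (2 * x)) * Real.sin (3 / 2 * ((j : ℝ) + 1) * (θ₁ + Real.pi / 3))) *
    (Real.exp (-r₂ ^ 2 / (2 * x)) * Real.sin (3 / 2 * ((j : ℝ) + 1) * (θ₂ + Real.pi / 3)))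

/-- The wedge heat kernel `p_x^N`, in polar coordinates:
`p_x^N(r₁e^{iθ₁}, r₂e^{iθ₂}) = (1/x) Σ_{j=1}^∞ I_{(3/2)j}(r₁r₂/x)
  ∏_{k=1,2} e^{-r_k²/(2x)} sin((3/2)j(θ_k + π/3))`. -/
noncomputable def pN (x r₁ θ₁ r₂ θ₂ : ℝ) : ℝ :=
  1 / x * ∑' j : ℕ, wedgeTerm x r₁ θ₁ r₂ θ₂ j

/-- Truncating Euler's integral at `t` gives `t ^ s * e ^ (-t) ≤ Γ(s + 1)`. -/
theorem rpow_mul_exp_neg_le_Gamma {s t : ℝ} (hs : 0 ≤ s) (ht : 0 ≤ t) :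
    t ^ s * Real.exp (-t) ≤ Real.Gamma (s + 1) := by
  have hint : MeasureTheory.IntegrableOn (fun u : ℝ => Real.exp (-u) * u ^ (s + 1 - 1))
      (Set.Ioi 0) := Real.GammaIntegral_convergent (by linarith)
  have hsub : Set.Ioi t ⊆ Set.Ioi (0 : ℝ) := Set.Ioi_subset_Ioi ht
  rw [Real.Gamma_eq_integral (by linarith)]
  calc t ^ s * Real.exp (-t) = ∫ u in Set.Ioi t, t ^ s * Real.exp (-u) := by
        rw [MeasureTheory.integral_const_mul, integral_exp_neg_Ioi]
    _ ≤ ∫ u in Set.Ioi t, Real.exp (-u) * u ^ (s + 1 - 1) := by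
        refine MeasureTheory.setIntegral_mono_on ((integrableOn_exp_neg_Ioi t).const_mul _)
          (hint.mono_set hsub) measurableSet_Ioi fun u hu => ?_
        rw [add_sub_cancel_right, mul_comm]
        have htu : t ≤ u := le_of_lt hu
        gcongr
    _ ≤ ∫ u in Set.Ioi 0, Real.exp (-u) * u ^ (s + 1 - 1) := by
        refine MeasureTheory.setIntegral_mono_set hint ?_ hsub.eventuallyLE
        filter_upwards [MeasureTheory.ae_restrict_mem measurableSet_Ioi] with u hu
        have : (0 : ℝ) ≤ u := le_of_lt hu
        positivity

theorem abs_besselI_le {α z : ℝ} (hα : 0 ≤ α) (hz : 0 ≤ z) :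
    |besselI α z| ≤
      (z / 2) ^ α / (Real.sqrt Real.pi * Real.Gamma (α + 1 / 2)) * (Real.exp z * Real.pi) := by
  have hΓ : 0 < Real.Gamma (α + 1 / 2) := Real.Gamma_pos_of_pos (by linarith)
  have hI : |∫ η in (0:ℝ)..Real.pi, Real.exp (z * Real.cos η) * Real.sin η ^ (2 * α)| ≤
      Real.exp z * |Real.pi - 0| := by
    rw [← Real.norm_eq_abs]
    refine intervalIntegral.norm_integral_le_of_norm_le_const fun η hη => ?_
    rw [Set.uIoc_of_le Real.pi_pos.le] at hη
    have h0 : 0 ≤ Real.sin η := Real.sin_nonneg_of_nonneg_of_le_pi hη.1.le hη.2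
    have h1 : Real.sin η ^ (2 * α) ≤ 1 :=
      Real.rpow_le_one h0 (Real.sin_le_one η) (by linarith)
    have h2 : Real.exp (z * Real.cos η) ≤ Real.exp z :=
      Real.exp_le_exp.2 (mul_le_of_le_one_right hz (Real.cos_le_one η))
    rw [Real.norm_of_nonneg (by positivity)]
    simpa using mul_le_mul h2 h1 (by positivity) (Real.exp_pos z).le
  rw [sub_zero, abs_of_pos Real.pi_pos] at hI
  rw [besselI, abs_mul, abs_of_nonneg (by positivity)]
  gcongr

/-- The Bessel functions of the wedge series decay geometrically in the index. -/
theorem abs_besselI_wedge_le {z : ℝ} (hz : 0 < z) (j : ℕ) :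
    |besselI (3 / 2 * ((j : ℝ) + 1)) z| ≤
      Real.sqrt Real.pi * z ^ ((3 : ℝ) / 2) * Real.exp (3 * z) * (1 / 8) ^ j := by
  set s : ℝ := 3 / 2 * j with hs_def
  have hs : 0 ≤ s := by positivity
  have hα : 3 / 2 * ((j : ℝ) + 1) = s + 3 / 2 := by rw [hs_def]; ring
  have hΓ : 0 < Real.Gamma (s + 1) := Real.Gamma_pos_of_pos (by linarith)
  have hΓ' : Real.Gamma (s + 1) ≤ Real.Gamma (s + 3 / 2 + 1 / 2) := by
    rw [show s + 3 / 2 + 1 / 2 = (s + 1) + 1 by ring, Real.Gamma_add_one (s := s + 1) (by positivity)]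
    nlinarith
  have h4 : (4 : ℝ) ^ s = 8 ^ j := by
    rw [hs_def, Real.rpow_mul (by norm_num), Real.rpow_natCast,
      show (4 : ℝ) = 2 ^ (2 : ℝ) by norm_num, ← Real.rpow_mul (by norm_num)]
    norm_num
  have key : (z / 2) ^ s ≤ Real.Gamma (s + 1) * Real.exp (2 * z) * (1 / 8) ^ j := by
    have h := rpow_mul_exp_neg_le_Gamma hs (t := 4 * (z / 2)) (by positivity)
    rw [Real.mul_rpow (by norm_num) (by positivity), h4, Real.exp_neg, ← div_eq_mul_inv,
      div_le_iff₀ (Real.exp_pos _), show 4 * (z / 2) = 2 * z by ring] at h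
    rw [one_div, inv_pow, ← div_eq_mul_inv, le_div_iff₀ (by positivity)]
    linarith
  have hhalf : (z / 2) ^ ((3 : ℝ) / 2) ≤ z ^ ((3 : ℝ) / 2) :=
    Real.rpow_le_rpow (by positivity) (by linarith) (by norm_num)
  have hπ : Real.sqrt Real.pi * Real.sqrt Real.pi = Real.pi := Real.mul_self_sqrt Real.pi_pos.le
  have hsq : 0 < Real.sqrt Real.pi := Real.sqrt_pos.2 Real.pi_pos
  rw [hα]
  refine (abs_besselI_le (by linarith) hz.le).trans ?_
  rw [Real.rpow_add (by positivity)]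
  calc (z / 2) ^ s * (z / 2) ^ ((3 : ℝ) / 2) /
          (Real.sqrt Real.pi * Real.Gamma (s + 3 / 2 + 1 / 2)) * (Real.exp z * Real.pi)
      ≤ (Real.Gamma (s + 1) * Real.exp (2 * z) * (1 / 8) ^ j) * z ^ ((3 : ℝ) / 2) /
          (Real.sqrt Real.pi * Real.Gamma (s + 1)) * (Real.exp z * Real.pi) := by
        gcongr
    _ = Real.sqrt Real.pi * z ^ ((3 : ℝ) / 2) * Real.exp (3 * z) * (1 / 8) ^ j := by
        rw [show 3 * z = 2 * z + z by ring, Real.exp_add]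
        field_simp
        linear_combination (-1 : ℝ) * hπ

theorem abs_sin_wedge_le {θ : ℝ} (hθ : θ ∈ Set.Icc (-(Real.pi / 3)) (Real.pi / 3)) (j : ℕ) :
    |Real.sin (3 / 2 * ((j : ℝ) + 1) * (θ + Real.pi / 3))| ≤
      3 / 2 * ((j : ℝ) + 1) * (Real.pi / 3 - |θ|) := by
  have hj : (0 : ℝ) ≤ 3 / 2 * ((j : ℝ) + 1) := by positivity
  rcases le_total 0 θ with h | h
  · have hrefl : |Real.sin (3 / 2 * ((j : ℝ) + 1) * (θ + Real.pi / 3))| =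
        |Real.sin (3 / 2 * ((j : ℝ) + 1) * (Real.pi / 3 - θ))| := by
      rw [show 3 / 2 * ((j : ℝ) + 1) * (θ + Real.pi / 3) =
        ((j + 1 : ℕ) : ℝ) * Real.pi - 3 / 2 * ((j : ℝ) + 1) * (Real.pi / 3 - θ) by
          push_cast; ring, Real.sin_nat_mul_pi_sub, abs_neg, abs_mul, abs_pow]
      simp
    rw [hrefl, abs_of_nonneg h]
    refine Real.abs_sin_le_abs.trans_eq (abs_of_nonneg ?_)
    exact mul_nonneg hj (by linarith [hθ.2])
  · rw [abs_of_nonpos h, sub_neg_eq_add, add_comm (Real.pi / 3)]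
    refine Real.abs_sin_le_abs.trans_eq (abs_of_nonneg ?_)
    exact mul_nonneg hj (by linarith [hθ.1])

theorem summable_succ_sq_mul_geometric :
    Summable fun j : ℕ => ((j : ℝ) + 1) ^ 2 * (1 / 8) ^ j := by
  have h := (summable_nat_add_iff 1).2
    (summable_pow_mul_geometric_of_norm_lt_one (R := ℝ) 2 (r := 1 / 8) (by norm_num))
  refine (h.mul_left 8).congr fun j => ?_
  push_cast
  ring

theorem abs_wedgeTerm_le {x r₁ r₂ θ₁ θ₂ : ℝ} (hx : 0 < x) (hr₁ : 0 < r₁) (hr₂ : 0 < r₂)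
    (hθ₁ : θ₁ ∈ Set.Icc (-(Real.pi / 3)) (Real.pi / 3))
    (hθ₂ : θ₂ ∈ Set.Icc (-(Real.pi / 3)) (Real.pi / 3)) (j : ℕ) :
    |wedgeTerm x r₁ θ₁ r₂ θ₂ j| ≤
      9 / 4 * Real.sqrt Real.pi * (r₁ * r₂ / x) ^ ((3 : ℝ) / 2) * Real.exp (3 * (r₁ * r₂ / x)) *
        (Real.exp (-r₁ ^ 2 / (2 * x)) * Real.exp (-r₂ ^ 2 / (2 * x))) *
        ((Real.pi / 3 - |θ₁|) * (Real.pi / 3 - |θ₂|)) * (((j : ℝ) + 1) ^ 2 * (1 / 8) ^ j) := by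
  have hd₁ : 0 ≤ Real.pi / 3 - |θ₁| := sub_nonneg.2 (abs_le.2 hθ₁)
  have hd₂ : 0 ≤ Real.pi / 3 - |θ₂| := sub_nonneg.2 (abs_le.2 hθ₂)
  have hz : 0 < r₁ * r₂ / x := by positivity
  rw [wedgeTerm, abs_mul, abs_mul, abs_mul, abs_mul, Real.abs_exp, Real.abs_exp]
  calc _ ≤ Real.sqrt Real.pi * (r₁ * r₂ / x) ^ ((3 : ℝ) / 2) * Real.exp (3 * (r₁ * r₂ / x)) *
            (1 / 8) ^ j *
          (Real.exp (-r₁ ^ 2 / (2 * x)) * (3 / 2 * ((j : ℝ) + 1) * (Real.pi / 3 - |θ₁|))) *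
          (Real.exp (-r₂ ^ 2 / (2 * x)) * (3 / 2 * ((j : ℝ) + 1) * (Real.pi / 3 - |θ₂|))) := by
        gcongr
        · exact abs_besselI_wedge_le hz j
        · exact abs_sin_wedge_le hθ₁ j
        · exact abs_sin_wedge_le hθ₂ j
    _ = _ := by ring

/-- Upper bound on the wedge heat kernel: there is `C > 0` such that for all `x > 0`,
`r₁, r₂ > 0`, `θ₁, θ₂ ∈ [-π/3, π/3]`, the series converges absolutely and
`p_x^N(r₁e^{iθ₁}, r₂e^{iθ₂}) ≤ C (r₁r₂)^{3/2} x^{-5/2} e^{(Cr₁r₂-r₁²-r₂²)/(2x)}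
  (π/3-|θ₁|)(π/3-|θ₂|)`. -/
theorem pN_upper_bound :
    ∃ C : ℝ, 0 < C ∧ ∀ x r₁ r₂ θ₁ θ₂ : ℝ, 0 < x → 0 < r₁ → 0 < r₂ →
      θ₁ ∈ Set.Icc (-(Real.pi / 3)) (Real.pi / 3) →
      θ₂ ∈ Set.Icc (-(Real.pi / 3)) (Real.pi / 3) →
      Summable (fun j : ℕ => |wedgeTerm x r₁ θ₁ r₂ θ₂ j|) ∧
      pN x r₁ θ₁ r₂ θ₂ ≤
        C * (r₁ * r₂) ^ ((3:ℝ) / 2) * x ^ (-(5:ℝ) / 2) *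
          Real.exp ((C * r₁ * r₂ - r₁ ^ 2 - r₂ ^ 2) / (2 * x)) *
          (Real.pi / 3 - |θ₁|) * (Real.pi / 3 - |θ₂|) := by
  set S : ℝ := ∑' j : ℕ, ((j : ℝ) + 1) ^ 2 * (1 / 8) ^ j
  set A : ℝ := 9 / 4 * Real.sqrt Real.pi * S
  have hA : 0 ≤ A := mul_nonneg (by positivity) (tsum_nonneg fun j => by positivity)
  refine ⟨A + 6, by linarith, fun x r₁ r₂ θ₁ θ₂ hx hr₁ hr₂ hθ₁ hθ₂ => ?_⟩
  have hbound := abs_wedgeTerm_le hx hr₁ hr₂ hθ₁ hθ₂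
  have hsum := summable_succ_sq_mul_geometric.mul_left
    (9 / 4 * Real.sqrt Real.pi * (r₁ * r₂ / x) ^ ((3 : ℝ) / 2) * Real.exp (3 * (r₁ * r₂ / x)) *
      (Real.exp (-r₁ ^ 2 / (2 * x)) * Real.exp (-r₂ ^ 2 / (2 * x))) *
      ((Real.pi / 3 - |θ₁|) * (Real.pi / 3 - |θ₂|)))
  have habs : Summable fun j : ℕ => |wedgeTerm x r₁ θ₁ r₂ θ₂ j| :=
    Summable.of_nonneg_of_le (fun _ => abs_nonneg _) hbound hsum
  refine ⟨habs, ?_⟩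
  have hd₁ : 0 ≤ Real.pi / 3 - |θ₁| := sub_nonneg.2 (abs_le.2 hθ₁)
  have hd₂ : 0 ≤ Real.pi / 3 - |θ₂| := sub_nonneg.2 (abs_le.2 hθ₂)
  have hle := habs.of_abs.tsum_le_tsum (fun j => (le_abs_self _).trans (hbound j)) hsum
  rw [tsum_mul_left] at hle
  have hpow : 1 / x * (r₁ * r₂ / x) ^ ((3 : ℝ) / 2) =
      (r₁ * r₂) ^ ((3 : ℝ) / 2) * x ^ (-(5 : ℝ) / 2) := by
    rw [Real.div_rpow (by positivity) hx.le, show -(5 : ℝ) / 2 = -1 + -(3 / 2) by norm_num,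
      Real.rpow_add hx, Real.rpow_neg_one, Real.rpow_neg hx.le]
    ring
  have hexp : Real.exp (3 * (r₁ * r₂ / x)) *
      (Real.exp (-r₁ ^ 2 / (2 * x)) * Real.exp (-r₂ ^ 2 / (2 * x))) =
      Real.exp ((6 * r₁ * r₂ - r₁ ^ 2 - r₂ ^ 2) / (2 * x)) := by
    rw [← Real.exp_add, ← Real.exp_add]
    congr 1
    field_simp
    ring
  have hC6 : 6 ≤ A + 6 := by linarith
  have hCA : A ≤ A + 6 := by linarith
  calc pN x r₁ θ₁ r₂ θ₂
      ≤ 1 / x * (9 / 4 * Real.sqrt Real.pi * (r₁ * r₂ / x) ^ ((3 : ℝ) / 2) *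
          Real.exp (3 * (r₁ * r₂ / x)) *
          (Real.exp (-r₁ ^ 2 / (2 * x)) * Real.exp (-r₂ ^ 2 / (2 * x))) *
          ((Real.pi / 3 - |θ₁|) * (Real.pi / 3 - |θ₂|)) * S) := by
        rw [pN]
        gcongr
    _ = A * (1 / x * (r₁ * r₂ / x) ^ ((3 : ℝ) / 2)) *
          (Real.exp (3 * (r₁ * r₂ / x)) *
            (Real.exp (-r₁ ^ 2 / (2 * x)) * Real.exp (-r₂ ^ 2 / (2 * x)))) *
          (Real.pi / 3 - |θ₁|) * (Real.pi / 3 - |θ₂|) := by ring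
    _ = A * (r₁ * r₂) ^ ((3 : ℝ) / 2) * x ^ (-(5 : ℝ) / 2) *
          Real.exp ((6 * r₁ * r₂ - r₁ ^ 2 - r₂ ^ 2) / (2 * x)) *
          (Real.pi / 3 - |θ₁|) * (Real.pi / 3 - |θ₂|) := by
        rw [hpow, hexp]
        ring
    _ ≤ _ := by gcongr
end
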